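/- arXiv:1802.03642 — 2 statements merged into one kernel-verified Lean document; each statement's English description precedes it below -/
import Mathlib

section
/- For every utility sequence u : ℕ → ℝ with |u_{t+1} − u_t| ≤ W for all t for some constant W, and every time bound T ∈ ℕ: inf { 𝔼_δ(u) | δ a stopping-time distribution with 𝔼_δ = T } = inf { 𝔼_δ(u) | δ a bi-Dirac stopping-time distribution with 𝔼_δ = T }. In other words, bi-Dirac distributions suffice for the adversary. -/
open scoped BigOperators

/-- A stopping-time distribution: pointwise nonnegative, total mass `1`,
with absolutely convergent expected time. -/
def IsStopDist (δ : ℕ → ℝ) : Prop :=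
  (∀ t, 0 ≤ δ t) ∧ Summable δ ∧ (∑' t, δ t) = 1 ∧
    Summable (fun t : ℕ => (t : ℝ) * δ t)

/-- The expected (stopping) time of `δ`. -/
noncomputable def expTime (δ : ℕ → ℝ) : ℝ := ∑' t : ℕ, (t : ℝ) * δ t

/-- The expected utility of the utility sequence `u` under `δ`. -/
noncomputable def expUtil (u δ : ℕ → ℝ) : ℝ := ∑' t : ℕ, u t * δ t

/-- The value of a utility sequence `u` under adversarial stopping-time
distributions with expected time `T`:
`val u T = inf { 𝔼_δ(u) | δ a stopping-time distribution with 𝔼_δ = T }`. -/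
noncomputable def val (u : ℕ → ℝ) (T : ℕ) : ℝ :=
  sInf {x | ∃ δ : ℕ → ℝ, IsStopDist δ ∧ (Summable fun t => u t * δ t) ∧
    expTime δ = (T : ℝ) ∧ x = expUtil u δ}

/-- Weighted sums against a combination of two point masses. -/
theorem hasSum_mul_single_add_single (f : ℕ → ℝ) (s t : ℕ) (p q : ℝ) :
    HasSum (fun i => f i * ((Pi.single s p : ℕ → ℝ) i + (Pi.single t q : ℕ → ℝ) i))
      (f s * p + f t * q) := by
  have point (a : ℕ) (r : ℝ) :
      HasSum (fun i => f i * (Pi.single a r : ℕ → ℝ) i) (f a * r) := by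
    have h := hasSum_single (f := fun i => f i * (Pi.single a r : ℕ → ℝ) i) a
      (fun i hi => by simp [Pi.single_eq_of_ne hi])
    simpa using h
  simpa only [mul_add] using (point s p).add (point t q)

/-- The expected utilities achieved by bi-Dirac distributions with mean `T`. -/
theorem exists_biDirac_expUtil_eq (u : ℕ → ℝ) (T s t : ℕ) {p q : ℝ} (hp : 0 ≤ p) (hq : 0 ≤ q)
    (hpq : p + q = 1) (hmean : (s : ℝ) * p + (t : ℝ) * q = T) :
    ∃ δ : ℕ → ℝ, IsStopDist δ ∧ (Summable fun t => u t * δ t) ∧ expTime δ = (T : ℝ) ∧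
      (∃ t₁ t₂ : ℕ, ∀ t, δ t ≠ 0 → t = t₁ ∨ t = t₂) ∧ u s * p + u t * q = expUtil u δ := by
  have hmass := hasSum_mul_single_add_single (fun _ => 1) s t p q
  simp only [one_mul, hpq] at hmass
  have htime := hasSum_mul_single_add_single (fun i => (i : ℝ)) s t p q
  have hutil := hasSum_mul_single_add_single u s t p q
  have nonneg (a : ℕ) {r : ℝ} (hr : 0 ≤ r) (i : ℕ) : 0 ≤ (Pi.single a r : ℕ → ℝ) i := by
    rw [Pi.single_apply]
    split_ifs <;> simp [hr]
  refine ⟨fun i => (Pi.single s p : ℕ → ℝ) i + (Pi.single t q : ℕ → ℝ) i,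
    ⟨fun i => add_nonneg (nonneg s hp i) (nonneg t hq i), hmass.summable, hmass.tsum_eq,
      htime.summable⟩, hutil.summable, htime.tsum_eq.trans hmean, ⟨s, t, fun i hi => ?_⟩,
    hutil.tsum_eq.symm⟩
  by_contra! h
  simp [Pi.single_eq_of_ne h.1, Pi.single_eq_of_ne h.2] at hi

/-- An affine minorant of `u` bounds the expected utility from below by its value at the
expected time. -/
theorem le_expUtil_of_affine_le {u δ : ℕ → ℝ} (hδ : IsStopDist δ)
    (hu : Summable fun t => u t * δ t) {a ν : ℝ} (h : ∀ t : ℕ, a + ν * t ≤ u t) :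
    a + ν * expTime δ ≤ expUtil u δ := by
  obtain ⟨hnonneg, hsum, hmass, htime⟩ := hδ
  have haff : HasSum (fun t : ℕ => a * δ t + ν * ((t : ℝ) * δ t)) (a * 1 + ν * expTime δ) :=
    ((hmass ▸ hsum.hasSum).mul_left a).add (htime.hasSum.mul_left ν)
  rw [mul_one] at haff
  refine hasSum_le (fun t => ?_) haff hu.hasSum
  have := mul_le_mul_of_nonneg_right (h t) (hnonneg t)
  linarith

/-- A sequence with increments bounded by `W` decreases at most linearly. -/
theorem sub_mul_le_of_abs_sub_le {u : ℕ → ℝ} {W : ℝ} (hW : ∀ t, |u (t + 1) - u t| ≤ W) (t : ℕ) :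
    u 0 + -W * t ≤ u t := by
  induction t with
  | zero => simp
  | succ t ih =>
    have := (abs_le.mp (hW t)).1
    push_cast
    linarith

/-- If `m` lies below all chords of `u` evaluated at `T`, then some line through `(T, m)` lies
below `u`. -/
theorem exists_affine_minorant {u : ℕ → ℝ} {W : ℝ} (hW : ∀ t, |u (t + 1) - u t| ≤ W) {T : ℕ}
    {m : ℝ} (hT : m ≤ u T)
    (hchord : ∀ s t : ℕ, s < T → T < t → m * ((t : ℝ) - s) ≤ u s * (t - T) + u t * (T - s)) :
    ∃ ν : ℝ, ∀ t : ℕ, m - ν * T + ν * t ≤ u t := by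
  rcases Nat.eq_zero_or_pos T with rfl | hpos
  · refine ⟨-W, fun t => ?_⟩
    have := sub_mul_le_of_abs_sub_le hW t
    push_cast
    linarith
  · obtain ⟨s, hs, hmax⟩ := Finset.exists_max_image (Finset.range T)
      (fun s : ℕ => (m - u s) / ((T : ℝ) - s)) ⟨0, Finset.mem_range.mpr hpos⟩
    rw [Finset.mem_range] at hs
    have hs' : (0 : ℝ) < T - s := sub_pos.mpr (Nat.cast_lt.mpr hs)
    refine ⟨(m - u s) / (T - s), fun t => ?_⟩
    rcases lt_trichotomy t T with ht | rfl | ht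
    · have ht' : (0 : ℝ) < T - t := sub_pos.mpr (Nat.cast_lt.mpr ht)
      have := (div_le_iff₀ ht').mp (hmax t (Finset.mem_range.mpr ht))
      linarith
    · linarith
    · have ht' : (0 : ℝ) < t - T := sub_pos.mpr (Nat.cast_lt.mpr ht)
      have hle : (m - u s) / (T - s) ≤ (u t - m) / (t - T) := by
        rw [div_le_div_iff₀ hs' ht']
        linarith [hchord s t hs ht]
      have := (le_div_iff₀ ht').mp hle
      linarith

/-- Bi-Dirac distributions are sufficient for the adversary:
the infimum of expected utilities over all stopping-time distributions with
expected time `T` equals the infimum over those whose support has at most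
two elements. -/
theorem biDirac_sufficient
    (u : ℕ → ℝ) (W : ℝ) (hW : ∀ t, |u (t + 1) - u t| ≤ W) (T : ℕ) :
    val u T =
      sInf {x | ∃ δ : ℕ → ℝ, IsStopDist δ ∧ (Summable fun t => u t * δ t) ∧
        expTime δ = (T : ℝ) ∧
        (∃ t₁ t₂ : ℕ, ∀ t, δ t ≠ 0 → t = t₁ ∨ t = t₂) ∧
        x = expUtil u δ} := by
  set A : Set ℝ := {x | ∃ δ : ℕ → ℝ, IsStopDist δ ∧ (Summable fun t => u t * δ t) ∧
    expTime δ = (T : ℝ) ∧ x = expUtil u δ}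
  set B : Set ℝ := {x | ∃ δ : ℕ → ℝ, IsStopDist δ ∧ (Summable fun t => u t * δ t) ∧
    expTime δ = (T : ℝ) ∧ (∃ t₁ t₂ : ℕ, ∀ t, δ t ≠ 0 → t = t₁ ∨ t = t₂) ∧
    x = expUtil u δ}
  change sInf A = sInf B
  have hBA : B ⊆ A := fun x ⟨δ, hδ, hu, hE, _, hx⟩ => ⟨δ, hδ, hu, hE, hx⟩
  have hbdd : BddBelow A := by
    refine ⟨u 0 + -W * T, ?_⟩
    rintro x ⟨δ, hδ, hu, hE, rfl⟩
    exact hE ▸ le_expUtil_of_affine_le hδ hu (sub_mul_le_of_abs_sub_le hW)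
  have hTB : u T ∈ B := by
    have := exists_biDirac_expUtil_eq u T T T zero_le_one le_rfl (add_zero 1) (by simp)
    rwa [mul_one, mul_zero, add_zero] at this
  refine le_antisymm (csInf_le_csInf hbdd ⟨_, hTB⟩ hBA) (le_csInf ⟨_, hBA hTB⟩ ?_)
  have hlower (x : ℝ) (hx : x ∈ B) : sInf B ≤ x := csInf_le (hbdd.mono hBA) hx
  obtain ⟨ν, hν⟩ := exists_affine_minorant hW (hlower _ hTB) fun s t hs ht => by
    have hs' : (0 : ℝ) < T - s := sub_pos.mpr (Nat.cast_lt.mpr hs)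
    have ht' : (0 : ℝ) < t - T := sub_pos.mpr (Nat.cast_lt.mpr ht)
    have hst : (0 : ℝ) < t - s := by linarith
    have h := hlower _ (exists_biDirac_expUtil_eq u T s t (div_nonneg ht'.le hst.le)
      (div_nonneg hs'.le hst.le) (by field_simp; ring) (by field_simp; ring))
    rwa [← mul_div_assoc, ← mul_div_assoc, ← add_div, le_div_iff₀ hst] at h
  rintro x ⟨δ, hδ, hu, hE, rfl⟩
  have := le_expUtil_of_affine_le hδ hu hν
  rw [hE] at this
  linarith
end

section
/- Let T ∈ ℕ and let ρ be an infinite path in a weighted graph G inducing utility sequence u, with ν = min_{0 ≤ t_1 ≤ T} inf_{t_2 ≥ T} (u_{t_2} − u_{t_1})/(t_2 − t_1) finite. Suppose ρ = A·C·σ where C is a cycle (its start and end vertex coincide) with average weight M_C < ν. Then the path ρ' = A·σ obtained by removing C from ρ satisfies val(ρ',T) ≥ val(ρ,T). -/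
open scoped BigOperators

/-- The sum of the weights of the first `n` edges of the infinite path with
vertex sequence `p` in the weighted graph with weight function `w`. -/
noncomputable def sumW {V : Type*} (w : V → V → ℤ) (p : ℕ → V) (n : ℕ) : ℝ :=
  ∑ k ∈ Finset.range n, (w (p k) (p (k + 1)) : ℝ)

/-- The utility sequence induced by the path with vertex sequence `p`:
`u i = ∑_{k ≤ i} w(e_k)`. -/
noncomputable def pathUtil {V : Type*} (w : V → V → ℤ) (p : ℕ → V) : ℕ → ℝ :=
  fun i => sumW w p (i + 1)

/-- The value of the infinite path with vertex sequence `p` under adversarial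
stopping-time distributions with expected time `T`. -/
noncomputable def pathVal {V : Type*} (w : V → V → ℤ) (p : ℕ → V) (T : ℕ) : ℝ :=
  val (pathUtil w p) T

/-- `p` is (the vertex sequence of) an infinite path from `v₀` in the graph
with edge relation `E`. -/
def IsPath {V : Type*} (E : V → V → Prop) (v₀ : V) (p : ℕ → V) : Prop :=
  p 0 = v₀ ∧ ∀ i, E (p i) (p (i + 1))

/-- `ν = min_{0 ≤ t₁ ≤ T} inf_{t₂ ≥ T} (u t₂ - u t₁)/(t₂ - t₁)` for the
utility sequence `u` induced by the path `p`. -/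
noncomputable def nuPath {V : Type*} (w : V → V → ℤ) (p : ℕ → V) (T : ℕ) : ℝ :=
  sInf {x | ∃ t₁ t₂ : ℕ, t₁ ≤ T ∧ T ≤ t₂ ∧ t₁ < t₂ ∧
    x = (pathUtil w p t₂ - pathUtil w p t₁) / ((t₂ : ℝ) - (t₁ : ℝ))}

/-- Summation against the two-point distribution with masses `α` at `s` and `β` at `t`. -/
lemma hasSum_mul_two_point (f : ℕ → ℝ) (s t : ℕ) (α β : ℝ) :
    HasSum (fun i => f i * ((if i = s then α else 0) + (if i = t then β else 0)))
      (α * f s + β * f t) := by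
  have hs := hasSum_ite_eq s (α * f s)
  have ht := hasSum_ite_eq t (β * f t)
  refine (hs.add ht).congr_fun ?_
  intro i
  split_ifs <;> subst_vars <;> ring

lemma exists_isStopDist_two_point (u : ℕ → ℝ) {T : ℝ} {s t : ℕ} {α β : ℝ} (hα : 0 ≤ α)
    (hβ : 0 ≤ β) (hαβ : α + β = 1) (hT : α * s + β * t = T) :
    ∃ δ : ℕ → ℝ, IsStopDist δ ∧ (Summable fun t => u t * δ t) ∧
      expTime δ = T ∧ α * u s + β * u t = expUtil u δ := by
  have hone := hasSum_mul_two_point (fun _ => 1) s t α β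
  simp only [one_mul, mul_one, hαβ] at hone
  have htime := hasSum_mul_two_point (fun t => (t : ℝ)) s t α β
  have hutil := hasSum_mul_two_point u s t α β
  refine ⟨_, ⟨fun i => ?_, hone.summable, hone.tsum_eq, htime.summable⟩,
    hutil.summable, htime.tsum_eq.trans hT, hutil.tsum_eq.symm⟩
  split_ifs <;> simp [hα, hβ, add_nonneg]

/-- A utility sequence lying above a line has expected utility at least the value of that line
at the expected stopping time. -/
lemma le_expUtil_of_line_le {u δ : ℕ → ℝ} {T v m : ℝ} (hδ : IsStopDist δ)
    (hu : Summable fun t => u t * δ t) (hT : expTime δ = T)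
    (h : ∀ t : ℕ, v + m * (t - T) ≤ u t) : v ≤ expUtil u δ := by
  obtain ⟨h0, hs, h1, hts⟩ := hδ
  have hline : HasSum (fun t : ℕ => (v - m * T) * δ t + m * (t * δ t))
      ((v - m * T) * 1 + m * T) := by
    have hδ1 : HasSum δ 1 := h1 ▸ hs.hasSum
    have hδT : HasSum (fun t : ℕ => (t : ℝ) * δ t) T := hT ▸ hts.hasSum
    exact (hδ1.mul_left _).add (hδT.mul_left _)
  have hle := hasSum_le (fun t => ?_) hline hu.hasSum
  · unfold expUtil
    linarith
  · have := mul_le_mul_of_nonneg_right (h t) (h0 t)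
    linarith

/-- The value of a utility sequence lying above a line is at least the value of that line
at the expected stopping time. -/
lemma le_val_of_line_le {u : ℕ → ℝ} {T : ℕ} {v m : ℝ}
    (h : ∀ t : ℕ, v + m * (t - T) ≤ u t) : v ≤ val u T := by
  refine le_csInf ?_ ?_
  · exact ⟨_, exists_isStopDist_two_point u (s := T) (t := T) zero_le_one le_rfl
      (add_zero 1) (by simp)⟩
  · rintro _ ⟨δ, hδ, hu, hT, rfl⟩
    exact le_expUtil_of_line_le hδ hu hT h

/-- The value is at most the expected utility of any two-point distribution with the right
expected time, provided the utility sequence lies above some line. -/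
lemma val_le_two_point {u : ℕ → ℝ} {T : ℕ} {v m : ℝ} (h : ∀ t : ℕ, v + m * (t - T) ≤ u t)
    {s t : ℕ} {α β : ℝ} (hα : 0 ≤ α) (hβ : 0 ≤ β) (hαβ : α + β = 1)
    (hT : α * s + β * t = T) : val u T ≤ α * u s + β * u t := by
  refine csInf_le ⟨v, ?_⟩ ?_
  · rintro _ ⟨δ, hδ, hu, hT, rfl⟩
    exact le_expUtil_of_line_le hδ hu hT h
  · exact exists_isStopDist_two_point u hα hβ hαβ hT

/-- If a utility sequence lies above some line and all its slopes from `T` onwards are at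
least `ν`, then it has a supporting line of slope at least `ν` through the point `(T, val u T)`. -/
lemma exists_supporting_line {u : ℕ → ℝ} {T : ℕ} {v m ν : ℝ}
    (h : ∀ t : ℕ, v + m * (t - T) ≤ u t)
    (hν : ∀ t : ℕ, T < t → ν * (t - T) ≤ u t - u T) :
    ∃ r, ν ≤ r ∧ ∀ t : ℕ, val u T + r * (t - T) ≤ u t := by
  have hvT : val u T ≤ u T := by
    simpa using val_le_two_point h (s := T) (t := T) zero_le_one le_rfl (by norm_num) (by simp)
  let q : {t : ℕ // T < t} → ℝ := fun t => (u t - val u T) / ((t : ℕ) - (T : ℝ))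
  have hpos : ∀ {s t : ℕ}, s < t → (0 : ℝ) < t - s := fun hst => sub_pos.2 (Nat.cast_lt.2 hst)
  have hq : ∀ t, ν ≤ q t := fun ⟨t, ht⟩ => by
    rw [le_div_iff₀ (hpos ht)]
    linarith [hν t ht]
  have : Nonempty {t : ℕ // T < t} := ⟨⟨T + 1, T.lt_succ_self⟩⟩
  refine ⟨⨅ t, q t, le_ciInf hq, fun t => ?_⟩
  rcases lt_trichotomy t T with ht | rfl | ht
  · have hslope : (val u T - u t) / ((T : ℝ) - t) ≤ ⨅ t, q t := by
      refine le_ciInf fun ⟨s, hs⟩ => ?_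
      have hst := hpos (ht.trans hs)
      rw [div_le_div_iff₀ (hpos ht) (hpos hs)]
      have := val_le_two_point h (s := t) (t := s) (α := (s - T) / (s - t))
        (β := (T - t) / (s - t)) (div_nonneg (hpos hs).le hst.le)
        (div_nonneg (hpos ht).le hst.le) (by field_simp; ring) (by field_simp; ring)
      have heq : ((s : ℝ) - T) / (s - t) * u t + (T - t) / (s - t) * u s
          = ((s - T) * u t + (T - t) * u s) / (s - t) := by ring
      rw [heq, le_div_iff₀ hst] at this
      linarith
    rw [div_le_iff₀ (hpos ht)] at hslope
    linarith
  · simpa using hvT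
  · have hle : ⨅ t, q t ≤ q ⟨t, ht⟩ := ciInf_le ⟨ν, by rintro _ ⟨t, rfl⟩; exact hq t⟩ _
    have := (le_div_iff₀ (hpos ht)).1 hle
    linarith

lemma exists_forall_neg_le_weight {V : Type*} [Finite V] (w : V → V → ℤ) :
    ∃ B : ℝ, ∀ x y, -B ≤ w x y := by
  obtain ⟨B, hB⟩ := (Set.finite_range fun x : V × V => -(w x.1 x.2 : ℝ)).bddAbove
  exact ⟨B, fun x y => neg_le.1 (hB ⟨(x, y), rfl⟩)⟩

lemma neg_mul_le_sumW_sub {V : Type*} {w : V → V → ℤ} {B : ℝ} (hB : ∀ x y, -B ≤ w x y)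
    (p : ℕ → V) {m n : ℕ} (hmn : m ≤ n) : -B * (n - m) ≤ sumW w p n - sumW w p m := by
  induction n, hmn using Nat.le_induction with
  | base => simp
  | succ n _ ih =>
    have := hB (p n) (p (n + 1))
    have hsucc : sumW w p (n + 1) = sumW w p n + w (p n) (p (n + 1)) :=
      Finset.sum_range_succ _ _
    push_cast
    linarith

lemma nuPath_mul_le {V : Type*} [Finite V] (w : V → V → ℤ) (p : ℕ → V) {T t : ℕ} (ht : T < t) :
    nuPath w p T * (t - T) ≤ pathUtil w p t - pathUtil w p T := by
  obtain ⟨B, hB⟩ := exists_forall_neg_le_weight w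
  rw [← le_div_iff₀ (sub_pos.2 (Nat.cast_lt.2 ht))]
  refine csInf_le ⟨-B, ?_⟩ ⟨T, t, le_rfl, ht.le, ht, rfl⟩
  rintro _ ⟨t₁, t₂, -, -, h, rfl⟩
  rw [le_div_iff₀ (sub_pos.2 (Nat.cast_lt.2 h))]
  have := neg_mul_le_sumW_sub hB p (Nat.succ_le_succ h.le)
  simpa [pathUtil] using this

lemma exists_line_le_pathUtil {V : Type*} [Finite V] (w : V → V → ℤ) (p : ℕ → V) (T : ℕ) :
    ∃ v m : ℝ, ∀ t : ℕ, v + m * (t - T) ≤ pathUtil w p t := by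
  obtain ⟨B, hB⟩ := exists_forall_neg_le_weight w
  refine ⟨-B * (T + 1), -B, fun t => ?_⟩
  have := neg_mul_le_sumW_sub hB p (Nat.zero_le (t + 1))
  have h0 : sumW w p 0 = 0 := Finset.sum_range_zero _
  push_cast at this
  unfold pathUtil
  linarith

lemma sumW_remove_cycle_of_le {V : Type*} (w : V → V → ℤ) {p : ℕ → V} {a c n : ℕ}
    (hcyc : p (a + c) = p a) (hn : n ≤ a) :
    sumW w (fun i => if i < a then p i else p (i + c)) n = sumW w p n := by
  refine Finset.sum_congr rfl fun k hk => ?_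
  have hka : k < a := (Finset.mem_range.1 hk).trans_le hn
  rcases (Nat.succ_le_of_lt hka).lt_or_eq with h | rfl
  · simp [hka, h]
  · simp [hcyc]

lemma sumW_remove_cycle_of_ge {V : Type*} (w : V → V → ℤ) {p : ℕ → V} {a c n : ℕ}
    (hcyc : p (a + c) = p a) (hn : a ≤ n) :
    sumW w (fun i => if i < a then p i else p (i + c)) n =
      sumW w p (n + c) - (sumW w p (a + c) - sumW w p a) := by
  induction n, hn using Nat.le_induction with
  | base => rw [sumW_remove_cycle_of_le w hcyc le_rfl]; ring
  | succ n hn ih =>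
    have hsucc (p : ℕ → V) (n : ℕ) : sumW w p (n + 1) = sumW w p n + w (p n) (p (n + 1)) :=
      Finset.sum_range_succ _ _
    rw [hsucc, ih, Nat.add_right_comm n 1 c, hsucc, if_neg hn.not_gt,
      if_neg (hn.trans n.le_succ).not_gt]
    ring

/-- Removing a bad cycle: if the path `p = A·C·σ` contains a cycle `C`
(edges `a, …, a+c-1`, with `p (a+c) = p a`) whose average weight
`M_C = (u_{a+c} - u_a)/c` is smaller than `ν`, then the path `A·σ` obtained by
removing `C` has value at least the value of `p`. -/
theorem remove_bad_cycle
    {V : Type*} [Fintype V]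
    (E : V → V → Prop) (w : V → V → ℤ) (T : ℕ)
    (v₀ : V) (p : ℕ → V) (hp : IsPath E v₀ p)
    (a c : ℕ) (hc : 1 ≤ c) (hcyc : p (a + c) = p a)
    (hbad : (sumW w p (a + c) - sumW w p a) / (c : ℝ) < nuPath w p T) :
    pathVal w p T ≤
      pathVal w (fun i => if i < a then p i else p (i + c)) T := by
  obtain ⟨v, m, h⟩ := exists_line_le_pathUtil w p T
  obtain ⟨r, hr, hline⟩ := exists_supporting_line h fun t ht => nuPath_mul_le w p ht
  refine le_val_of_line_le (m := r) fun t => ?_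
  rcases le_total (t + 1) a with ht | ht
  · exact (hline t).trans_eq (sumW_remove_cycle_of_le w hcyc ht).symm
  · have hcr : sumW w p (a + c) - sumW w p a ≤ r * c :=
      (div_le_iff₀ (Nat.cast_pos.2 hc)).1 (hbad.le.trans hr)
    have := hline (t + c)
    simp only [pathVal, pathUtil] at this ⊢
    rw [sumW_remove_cycle_of_ge w hcyc ht, Nat.add_right_comm t 1 c]
    push_cast at this
    linarith
end
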